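/- Let m ≥ 1 and a, b_1,…,b_m, c_1,…,c_m ∈ ℂ with a ≠ 0, β_{0,i} = b_i ≠ 0 and β_{1,i} = c_i − 1 − b_i ≠ 0 for all i; for v ∈ {0,1}^m set Σβ_v = Σ_i β_{v_i,i}, Πβ_v = ∏_i β_{v_i,i}, γ_v = a − Σ_i v_i c_i + |v|. Let G be the 2^m × 2^m matrix indexed by {0,1}^m with entries: G_{v,v} = (a − Σβ_v)/(a·Πβ_v); G_{v,v'} = −1/(a·∏_{i: v_i = v'_i} β_{v_i,i}) if v and v' differ in exactly one coordinate; and G_{v,v'} = 0 otherwise. Then det(G) = (∏_{w∈{0,1}^m} γ_w) / (a^{2^m}·∏_{i=1}^m (β_{0,i}β_{1,i})^{2^{m−1}}). -/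

import Mathlib

open Finset
open scoped Classical

/-- `v_i ∈ {0,1}` regarded as a complex number. -/
noncomputable def bval (s : Bool) : ℂ := if s then 1 else 0

/-- The parameters `β_{0,i} = b_i`, `β_{1,i} = c_i − 1 − b_i`. -/
noncomputable def betaP {m : ℕ} (b c : Fin m → ℂ) (s : Bool) (i : Fin m) : ℂ :=
  if s then c i - 1 - b i else b i

/-- `σ_k·v` : flip the `k`-th coordinate of `v`. -/
def flipv {m : ℕ} (k : Fin m) (v : Fin m → Bool) : Fin m → Bool :=
  Function.update v k (!(v k))

/-- The weight `|v| = Σ v_i` of `v ∈ {0,1}^m`. -/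
def wt {m : ℕ} (v : Fin m → Bool) : ℕ := ∑ i, if v i then 1 else 0

/-- `γ_w = a − Σ_i w_i c_i + |w|`. -/
noncomputable def gammaP {m : ℕ} (a : ℂ) (c : Fin m → ℂ) (w : Fin m → Bool) : ℂ :=
  a - ∑ i, (if w i then c i else 0) + (wt w : ℂ)

/-- `A_w = Σ ∏_{j=1}^r 1/γ_{w^{(j)}}`, the sum over all chains
`w = w^{(r)} ≻ w^{(r−1)} ≻ ⋯ ≻ w^{(1)}` with `|w^{(j)}| = j` (here `r = |w|`;
a chain is encoded as `ch : Fin r → {0,1}^m` with `ch j = w^{(j+1)}`, the conditions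
on weights making the inclusions automatically strict);
for `w = (0,…,0)` the empty chain gives `A_w = 1`. -/
noncomputable def Aw {m : ℕ} (γ : (Fin m → Bool) → ℂ) (w : Fin m → Bool) : ℂ :=
  ∑ ch ∈ (univ : Finset (Fin (wt w) → Fin m → Bool)).filter
      (fun ch =>
        (∀ j : Fin (wt w), wt (ch j) = j.val + 1) ∧
        (∀ j : Fin (wt w), j.val = wt w - 1 → ch j = w) ∧
        (∀ j j' : Fin (wt w), j'.val = j.val + 1 →
          ∀ i, ch j i = true → ch j' i = true)),
    ∏ j, 1 / γ (ch j)

/-- The intersection matrix `C` with entries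
`C_{v,v'} = Σ_w A_w · ∏_{i : w_i = 0} δ(v_i, v'_i)/β_{v_i,i}`. -/
noncomputable def Cmat {m : ℕ} (a : ℂ) (b c : Fin m → ℂ) :
    Matrix (Fin m → Bool) (Fin m → Bool) ℂ :=
  fun v v' => ∑ w, Aw (gammaP a c) w *
    ∏ i ∈ univ.filter (fun i => w i = false),
      (if v i = v' i then 1 else 0) / betaP b c (v i) i

/-- `Σβ_v = Σ_i β_{v_i,i}`. -/
noncomputable def Sbeta {m : ℕ} (b c : Fin m → ℂ) (v : Fin m → Bool) : ℂ :=
  ∑ i, betaP b c (v i) i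

/-- `Πβ_v = ∏_i β_{v_i,i}`. -/
noncomputable def Pbeta {m : ℕ} (b c : Fin m → ℂ) (v : Fin m → Bool) : ℂ :=
  ∏ i, betaP b c (v i) i

/-- The standard basis row vector `e_v` of `ℂ^{2^m}`, `(e_v)_w = δ_{v,w}`. -/
noncomputable def evec {m : ℕ} (v : Fin m → Bool) : (Fin m → Bool) → ℂ :=
  fun w => if w = v then 1 else 0

/-- The coordinate row vector `f_v = ((a − Σβ_v)/a) e_v − Σ_j (β_{1−v_j,j}/a) e_{σ_j·v}`
of the class `ψ_v` in the frame `(φ_v)`. -/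
noncomputable def fvec {m : ℕ} (a : ℂ) (b c : Fin m → ℂ) (v : Fin m → Bool) :
    (Fin m → Bool) → ℂ :=
  ((a - Sbeta b c v) / a) • evec v - ∑ j, (betaP b c (!(v j)) j / a) • evec (flipv j v)

/-- The residue matrix `R_k`: `(R_k)_{v,v} = −β_{v_k,k}`, `(R_k)_{v,σ_k·v} = −β_{1−v_k,k}`,
all other entries `0`. -/
noncomputable def Rmat {m : ℕ} (b c : Fin m → ℂ) (k : Fin m) :
    Matrix (Fin m → Bool) (Fin m → Bool) ℂ :=
  fun v w =>
    if w = v then -betaP b c (v k) k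
    else if w = flipv k v then -betaP b c (!(v k)) k
    else 0

/-- The matrix `G` of intersection numbers `(2π√−1)^{−m}·I(ψ_{x,v}, ψ_{x,v'})`:
`G_{v,v} = (a − Σβ_v)/(a·Πβ_v)`, `G_{v,v'} = −1/(a·∏_{i: v_i = v'_i} β_{v_i,i})`
if `v, v'` differ in exactly one coordinate, and `G_{v,v'} = 0` otherwise. -/
noncomputable def Gmat {m : ℕ} (a : ℂ) (b c : Fin m → ℂ) :
    Matrix (Fin m → Bool) (Fin m → Bool) ℂ :=
  fun v v' =>
    if v = v' then (a - Sbeta b c v) / (a * Pbeta b c v)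
    else if (univ.filter (fun i => v i ≠ v' i)).card = 1 then
      -1 / (a * ∏ i ∈ univ.filter (fun i => v i = v' i), betaP b c (v i) i)
    else 0

/-- A matrix whose off-diagonal entries vanish unless they strictly raise the weight `f`
has determinant the product of its diagonal. -/
theorem det_eq_prod_diag_of_weight {n R : Type*} [Fintype n] [DecidableEq n] [CommRing R]
    (f : n → ℕ) (M : Matrix n n R) (h : ∀ i j, i ≠ j → f j ≤ f i → M i j = 0) :
    M.det = ∏ i, M i i := by
  have hM : M.BlockTriangular f := fun i j hij =>
    h i j (by rintro rfl; exact lt_irrefl _ hij) hij.le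
  rw [hM.det]
  have hblock : ∀ k, (M.toSquareBlock f k).det = ∏ i : {i // f i = k}, M i i := by
    intro k
    rw [← Matrix.det_diagonal]
    congr 1
    ext i j
    by_cases hij : i = j
    · subst hij
      simp [Matrix.toSquareBlock_def]
    · rw [Matrix.diagonal_apply_ne _ hij]
      exact h _ _ (fun e => hij (Subtype.ext e)) (by rw [i.2, j.2])
  rw [← Finset.prod_fiberwise_of_maps_to (g := f) (t := univ.image f)
    (fun i hi => mem_image_of_mem f hi)]
  refine prod_congr rfl fun k _ => ?_
  rw [hblock, Finset.prod_subtype (p := fun i => f i = k)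
    (univ.filter fun i => f i = k) (by simp) (fun i => M i i)]

theorem flipv_flipv {m : ℕ} (k : Fin m) (v : Fin m → Bool) : flipv k (flipv k v) = v := by
  simp [flipv]

theorem flipv_same {m : ℕ} (k : Fin m) (v : Fin m → Bool) : flipv k v k = !(v k) := by
  simp [flipv]

theorem flipv_of_ne {m : ℕ} {k i : Fin m} (h : i ≠ k) (v : Fin m → Bool) :
    flipv k v i = v i := by
  simp [flipv, h]

theorem flipv_ne {m : ℕ} (k : Fin m) (v : Fin m → Bool) : flipv k v ≠ v := by
  intro h
  have := congrFun h k
  rw [flipv_same] at this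
  simp at this

theorem wt_strictMono {m : ℕ} : StrictMono (wt : (Fin m → Bool) → ℕ) := by
  intro v w h
  obtain ⟨hle, i, hi⟩ := Pi.lt_def.mp h
  refine Finset.sum_lt_sum (fun j _ => ?_) ⟨i, mem_univ i, ?_⟩
  · have := hle j
    revert this
    cases v j <;> cases w j <;> simp
  · revert hi
    cases v i <;> cases w i <;> simp

theorem lt_flipv {m : ℕ} {k : Fin m} {v : Fin m → Bool} (h : v k = false) : v < flipv k v := by
  refine lt_of_le_of_ne (fun i => ?_) (flipv_ne k v).symm
  by_cases hi : i = k
  · subst hi; simp [h]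
  · rw [flipv_of_ne hi]

theorem flipv_le_iff {m : ℕ} {k : Fin m} {v w : Fin m → Bool} (h : w k = true) :
    flipv k v ≤ w ↔ v ≤ w := by
  simp only [Pi.le_def]
  refine forall_congr' fun i => ?_
  by_cases hi : i = k
  · subst hi; simp [h]
  · rw [flipv_of_ne hi]

theorem le_flipv_iff {m : ℕ} {k : Fin m} {v w : Fin m → Bool} (h : v k = false) :
    v ≤ flipv k w ↔ v ≤ w := by
  simp only [Pi.le_def]
  refine forall_congr' fun i => ?_
  by_cases hi : i = k
  · subst hi; simp [h]
  · rw [flipv_of_ne hi]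

/-- The zeta matrix of the Boolean lattice. -/
noncomputable def zetaMat (m : ℕ) : Matrix (Fin m → Bool) (Fin m → Bool) ℂ :=
  fun w v => if v ≤ w then 1 else 0

theorem det_zetaMat (m : ℕ) : (zetaMat m).det = 1 := by
  rw [← Matrix.det_transpose, det_eq_prod_diag_of_weight wt]
  · simp [zetaMat]
  · intro v w hne hwt
    simp only [Matrix.transpose_apply, zetaMat, ite_eq_right_iff, one_ne_zero, imp_false]
    intro hle
    exact absurd (wt_strictMono (lt_of_le_of_ne hle hne)) (not_lt.mpr hwt)

/-- The rank-one block `(β_{0,k}, β_{1,k})ᵀ (1, 1)` acting on the `k`-th coordinate. -/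
noncomputable def coordMat {m : ℕ} (b c : Fin m → ℂ) (k : Fin m) :
    Matrix (Fin m → Bool) (Fin m → Bool) ℂ :=
  fun u v => (if u = v then betaP b c (u k) k else 0) +
    (if u = flipv k v then betaP b c (u k) k else 0)

/-- The triangular form of `coordMat` in the basis given by `zetaMat`. -/
noncomputable def triMat {m : ℕ} (b c : Fin m → ℂ) (k : Fin m) :
    Matrix (Fin m → Bool) (Fin m → Bool) ℂ :=
  fun w u => (if u = w then (if w k then c k - 1 else 0) else 0) +
    (if u = flipv k w then (if w k then 0 else b k) else 0)

theorem zetaMat_mul_coordMat {m : ℕ} (b c : Fin m → ℂ) (k : Fin m) :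
    zetaMat m * coordMat b c k = triMat b c k * zetaMat m := by
  ext w v
  have hl : (zetaMat m * coordMat b c k) w v =
      zetaMat m w v * betaP b c (v k) k +
        zetaMat m w (flipv k v) * betaP b c (!(v k)) k := by
    simp [Matrix.mul_apply, coordMat, mul_add, sum_add_distrib, flipv_same]
  have hr : (triMat b c k * zetaMat m) w v =
      (if w k then c k - 1 else 0) * zetaMat m w v +
        (if w k then 0 else b k) * zetaMat m (flipv k w) v := by
    simp [Matrix.mul_apply, triMat, add_mul, sum_add_distrib]
  rw [hl, hr]
  cases hw : w k
  · cases hv : v k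
    · have h1 : ¬ flipv k v ≤ w := fun h => by
        have := h k
        simp [flipv_same, hv, hw, Bool.le_iff_imp] at this
      simp [zetaMat, h1, le_flipv_iff hv, betaP, mul_comm]
    · have h1 : ¬ v ≤ w := fun h => by
        have := h k
        simp [hv, hw, Bool.le_iff_imp] at this
      have h2 : v ≤ flipv k w ↔ flipv k v ≤ w := by
        rw [← flipv_le_iff (k := k) (by simp [flipv_same, hw]),
          le_flipv_iff (by simp [flipv_same, hv])]
      simp [zetaMat, h1, h2, betaP, mul_comm]
  · simp only [zetaMat, flipv_le_iff hw]
    cases v k <;> simp [betaP] <;> split_ifs <;> ring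

theorem gammaP_eq {m : ℕ} (a : ℂ) (c : Fin m → ℂ) (w : Fin m → Bool) :
    gammaP a c w = a - ∑ k, (if w k then c k - 1 else 0) := by
  have : (wt w : ℂ) = ∑ k, (if w k then 1 else 0) := by simp [wt]
  rw [gammaP, this, sub_add, ← sum_sub_distrib]
  congr 1
  refine sum_congr rfl fun k _ => ?_
  split_ifs <;> simp

theorem det_sub_sum_triMat {m : ℕ} (a : ℂ) (b c : Fin m → ℂ) :
    (Matrix.scalar _ a - ∑ k, triMat b c k).det = ∏ w, gammaP a c w := by
  rw [det_eq_prod_diag_of_weight wt]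
  · refine prod_congr rfl fun w _ => ?_
    rw [gammaP_eq]
    simp [Matrix.sum_apply, triMat, (flipv_ne _ w).symm]
  · intro w u hne hwt
    have : ∀ k, triMat b c k w u = 0 := by
      intro k
      simp only [triMat, hne.symm, if_false, zero_add, ite_eq_right_iff]
      rintro rfl
      cases hw : w k
      · exact absurd (wt_strictMono (lt_flipv hw)) (not_lt.mpr hwt)
      · simp
    simp [Matrix.sum_apply, this, hne]

theorem det_sub_sum_coordMat {m : ℕ} (a : ℂ) (b c : Fin m → ℂ) :
    (Matrix.scalar _ a - ∑ k, coordMat b c k).det = ∏ w, gammaP a c w := by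
  have h : zetaMat m * (Matrix.scalar _ a - ∑ k, coordMat b c k) =
      (Matrix.scalar _ a - ∑ k, triMat b c k) * zetaMat m := by
    simp only [mul_sub, sub_mul, mul_sum, sum_mul, zetaMat_mul_coordMat]
    rw [(Matrix.scalar_commute a (fun _ => Commute.all _ _) (zetaMat m)).eq]
  have := congrArg Matrix.det h
  rwa [Matrix.det_mul, Matrix.det_mul, det_zetaMat, one_mul, mul_one,
    det_sub_sum_triMat] at this

theorem filter_ne_eq_singleton_iff {m : ℕ} (k : Fin m) (v w : Fin m → Bool) :
    univ.filter (fun i => v i ≠ w i) = {k} ↔ v = flipv k w := by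
  constructor
  · intro h
    have h' : ∀ i, v i ≠ w i ↔ i = k := fun i => by simpa using Finset.ext_iff.mp h i
    funext i
    by_cases hi : i = k
    · subst hi
      rw [flipv_same]
      exact Bool.eq_not.mpr ((h' i).mpr rfl)
    · rw [flipv_of_ne hi]
      exact not_not.mp (mt (h' i).mp hi)
  · rintro rfl
    ext i
    by_cases hi : i = k
    · subst hi; simp [flipv_same]
    · simp [flipv_of_ne hi, hi]

theorem Gmat_eq_diagonal_mul {m : ℕ} (a : ℂ) (b c : Fin m → ℂ)
    (hb : ∀ s i, betaP b c s i ≠ 0) (ha : a ≠ 0) :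
    Gmat a b c = Matrix.diagonal (fun v => (a * Pbeta b c v)⁻¹) *
      (Matrix.scalar _ a - ∑ k, coordMat b c k) := by
  ext v w
  rw [Matrix.diagonal_mul, Matrix.sub_apply, Matrix.sum_apply]
  by_cases hvw : v = w
  · subst hvw
    simp [Gmat, coordMat, (flipv_ne _ v).symm, Sbeta, div_eq_inv_mul]
  · simp only [Gmat, hvw, if_false, coordMat, zero_add, ← filter_ne_eq_singleton_iff,
      Matrix.scalar_apply, Matrix.diagonal_apply_ne _ hvw]
    split_ifs with hcard
    · obtain ⟨k, hk⟩ := card_eq_one.mp hcard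
      have hprod : Pbeta b c v = betaP b c (v k) k *
          ∏ i ∈ univ.filter (fun i => v i = w i), betaP b c (v i) i := by
        rw [Pbeta, ← prod_filter_mul_prod_filter_not univ (fun i => v i ≠ w i), hk,
          prod_singleton]
        simp
      have hne : ∏ i ∈ univ.filter (fun i => v i = w i), betaP b c (v i) i ≠ 0 :=
        prod_ne_zero_iff.mpr fun i _ => hb _ _
      have hk0 := hb (v k) k
      simp only [hk, singleton_inj, sum_ite_eq, mem_univ, if_true, hprod]
      field_simp
      simp
    · have : ∀ k, univ.filter (fun i => v i ≠ w i) ≠ {k} := fun k hk =>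
        hcard (by rw [hk, card_singleton])
      simp [this]

theorem prod_apply_bool {M : Type*} [CommMonoid M] {m : ℕ} (f : Bool → M) (i : Fin m) :
    ∏ v : Fin m → Bool, f (v i) = (f false * f true) ^ (2 ^ (m - 1)) := by
  obtain _ | n := m
  · exact i.elim0
  · rw [← (Fin.insertNthEquiv (fun _ => Bool) i).prod_comp, Fintype.prod_prod_type]
    simp [mul_pow, mul_comm]

theorem prod_mul_Pbeta {m : ℕ} (a : ℂ) (b c : Fin m → ℂ) :
    ∏ v, (a * Pbeta b c v) =
      a ^ (2 ^ m) * ∏ i, (betaP b c false i * betaP b c true i) ^ (2 ^ (m - 1)) := by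
  simp only [prod_mul_distrib, Pbeta]
  rw [prod_comm]
  congr 1
  · simp
  · exact prod_congr rfl fun i _ => prod_apply_bool (fun s => betaP b c s i) i

/-- **Proposition 3.5 (proof), determinant of the `ψ`-intersection matrix:**
`det G = (∏_w γ_w) / (a^{2^m}·∏_i (β_{0,i}β_{1,i})^{2^{m−1}})`. -/
theorem stmt_5 (m : ℕ) (hm : 1 ≤ m) (a : ℂ) (b c : Fin m → ℂ) (ha : a ≠ 0)
    (hb0 : ∀ i, betaP b c false i ≠ 0) (hb1 : ∀ i, betaP b c true i ≠ 0) :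
    (Gmat a b c).det =
      (∏ w : Fin m → Bool, gammaP a c w) /
        (a ^ (2 ^ m) *
          ∏ i, (betaP b c false i * betaP b c true i) ^ (2 ^ (m - 1))) := by
  have hb : ∀ s i, betaP b c s i ≠ 0 := fun s i => by
    cases s
    exacts [hb0 i, hb1 i]
  rw [Gmat_eq_diagonal_mul a b c hb ha, Matrix.det_mul, Matrix.det_diagonal,
    det_sub_sum_coordMat, prod_inv_distrib, prod_mul_Pbeta, div_eq_inv_mul]
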